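/- arXiv:2108.11307 — 2 statements merged into one kernel-verified Lean document; each statement's English description precedes it below -/
import Mathlib

section
/- Let $\alpha\in(0,1)$, $T>0$, and let $\widetilde z\in C([0,T])$ with $\widetilde z(0)=0$. Suppose $\widetilde z$ attains a positive maximum over $[0,T]$ at a point $t_1\in(0,T]$. Then the Riemann–Liouville derivative satisfies $\frac{d}{dt}\big(J^\alpha \widetilde z\big)(t_1) \ge \frac{t_1^{\alpha-1}}{\Gamma(\alpha)}\,\widetilde z(t_1) > 0$, provided $J^\alpha\widetilde z$ is differentiable at $t_1$. -/
open Real MeasureTheory intervalIntegral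

/-- Riemann–Liouville fractional integral of order `α`. -/
noncomputable def rlIntegral (α : ℝ) (g : ℝ → ℝ) (t : ℝ) : ℝ :=
  (1 / Real.Gamma α) * ∫ τ in (0:ℝ)..t, (t - τ) ^ (α - 1) * g τ

theorem intervalIntegrable_sub_rpow_mul {p : ℝ} (hp : -1 < p) {f : ℝ → ℝ} (hf : Continuous f)
    (a b t : ℝ) : IntervalIntegrable (fun τ => (t - τ) ^ p * f τ) volume a b := by
  have h := (intervalIntegrable_rpow' (a := t - a) (b := t - b) hp).comp_sub_left t
  simp only [sub_sub_cancel] at h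
  exact h.mul_continuousOn hf.continuousOn

theorem integral_sub_rpow {p : ℝ} (hp : -1 < p) (s b : ℝ) :
    ∫ τ in s..b, (b - τ) ^ p = (b - s) ^ (p + 1) / (p + 1) := by
  rw [intervalIntegral.integral_comp_sub_left (fun x : ℝ => x ^ p), sub_self,
    integral_rpow (Or.inl hp), Real.zero_rpow (by linarith), sub_zero]

/-- A nonpositive power kernel is antitone in its base point. -/
theorem integral_sub_rpow_mul_antitone {p : ℝ} (hp : p ≤ 0) {f : ℝ → ℝ} {a s t u : ℝ}
    (hau : a ≤ u) (hus : u ≤ s) (hst : s ≤ t) (hf : ∀ τ ∈ Set.Ioo a u, 0 ≤ f τ)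
    (h₁ : IntervalIntegrable (fun τ => (t - τ) ^ p * f τ) volume a u)
    (h₂ : IntervalIntegrable (fun τ => (s - τ) ^ p * f τ) volume a u) :
    ∫ τ in a..u, (t - τ) ^ p * f τ ≤ ∫ τ in a..u, (s - τ) ^ p * f τ := by
  refine intervalIntegral.integral_mono_on_of_le_Ioo hau h₁ h₂ fun τ hτ => ?_
  exact mul_le_mul_of_nonneg_right
    (Real.rpow_le_rpow_of_nonpos (by linarith [hτ.2]) (by linarith) hp) (hf τ hτ)

theorem intervalIntegrable_sub_rpow_mul_sub_rpow {p q : ℝ} (hp : -1 < p) (hq : -1 < q)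
    {σ t : ℝ} (h : σ < t) :
    IntervalIntegrable (fun τ => (t - τ) ^ p * (τ - σ) ^ q) volume σ t := by
  have hl : IntervalIntegrable (fun τ => (t - τ) ^ p * (τ - σ) ^ q) volume σ ((σ + t) / 2) := by
    have h' := (intervalIntegrable_rpow' (a := σ - σ) (b := (σ + t) / 2 - σ) hq).comp_sub_right σ
    simp only [sub_add_cancel] at h'
    refine h'.continuousOn_mul (ContinuousOn.rpow_const (by fun_prop) fun x hx => Or.inl ?_)
    rw [Set.uIcc_of_le (by linarith)] at hx
    linarith [hx.2]
  have hr : IntervalIntegrable (fun τ => (t - τ) ^ p * (τ - σ) ^ q) volume ((σ + t) / 2) t := by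
    have h' := (intervalIntegrable_rpow' (a := t - (σ + t) / 2) (b := t - t) hp).comp_sub_left t
    simp only [sub_sub_cancel] at h'
    refine h'.mul_continuousOn (ContinuousOn.rpow_const (by fun_prop) fun x hx => Or.inl ?_)
    rw [Set.uIcc_of_le (by linarith)] at hx
    linarith [hx.1]
  exact hl.trans hr

/-- Conjugate kernels: the integral does not depend on the interval. -/
theorem integral_sub_rpow_mul_sub_rpow (α : ℝ) {σ t : ℝ} (h : σ < t) :
    ∫ τ in σ..t, (t - τ) ^ (-α) * (τ - σ) ^ (α - 1) =
      ∫ x in (0 : ℝ)..1, (1 - x) ^ (-α) * x ^ (α - 1) := by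
  have hd : 0 < t - σ := sub_pos.2 h
  have key := intervalIntegral.smul_integral_comp_mul_add (a := 0) (b := 1)
    (fun τ => (t - τ) ^ (-α) * (τ - σ) ^ (α - 1)) (t - σ) σ
  simp only [mul_zero, zero_add, mul_one, sub_add_cancel, add_sub_cancel_right] at key
  rw [← key, ← intervalIntegral.integral_smul]
  refine intervalIntegral.integral_congr fun x hx => ?_
  rw [Set.uIcc_of_le zero_le_one] at hx
  have e : t - ((t - σ) * x + σ) = (t - σ) * (1 - x) := by ring
  simp only [smul_eq_mul]
  rw [e, Real.mul_rpow hd.le (by linarith [hx.2]), Real.mul_rpow hd.le hx.1]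
  have e2 : (t - σ) * ((t - σ) ^ (-α) * (t - σ) ^ (α - 1)) = 1 := by
    rw [← Real.rpow_add hd, show -α + (α - 1) = -1 by ring, Real.rpow_neg_one,
      mul_inv_cancel₀ hd.ne']
  linear_combination ((1 - x) ^ (-α) * x ^ (α - 1)) * e2

/-- Abel's inversion: integrating against the conjugate kernel recovers the primitive. -/
theorem abel_integral {α : ℝ} (hα : α ∈ Set.Ioo (0 : ℝ) 1) {w : ℝ → ℝ} (hw : Continuous w)
    {a t : ℝ} (hat : a ≤ t) :
    IntervalIntegrable
      (fun τ => (t - τ) ^ (-α) * ∫ σ in a..τ, (τ - σ) ^ (α - 1) * w σ) volume a t ∧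
    ∫ τ in a..t, (t - τ) ^ (-α) * ∫ σ in a..τ, (τ - σ) ^ (α - 1) * w σ =
      (∫ x in (0 : ℝ)..1, (1 - x) ^ (-α) * x ^ (α - 1)) * ∫ σ in a..t, w σ := by
  obtain ⟨hα0, hα1⟩ := hα
  set C := ∫ x in (0 : ℝ)..1, (1 - x) ^ (-α) * x ^ (α - 1) with hC
  set F : ℝ → ℝ → ℝ := fun τ σ =>
    if σ < τ then (t - τ) ^ (-α) * (τ - σ) ^ (α - 1) * w σ else 0 with hF
  set μ := (volume : Measure ℝ).restrict (Set.Ioc a t) with hμ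
  have hmeas : Measurable (Function.uncurry F) := by
    refine Measurable.ite (measurableSet_lt measurable_snd measurable_fst) ?_ measurable_const
    have := hw.measurable
    fun_prop
  have hF_left : ∀ τ ∈ Set.Ioc a t,
      ∫ σ, F τ σ ∂μ = (t - τ) ^ (-α) * ∫ σ in a..τ, (τ - σ) ^ (α - 1) * w σ := by
    intro τ hτ
    have e : F τ = (Set.Iio τ).indicator
        (fun σ => (t - τ) ^ (-α) * ((τ - σ) ^ (α - 1) * w σ)) := by
      ext σ
      simp only [hF, Set.indicator_apply, Set.mem_Iio, mul_assoc]
    rw [e, MeasureTheory.integral_indicator measurableSet_Iio, hμ,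
      Measure.restrict_restrict measurableSet_Iio,
      intervalIntegral.integral_of_le hτ.1.le, ← MeasureTheory.integral_const_mul,
      MeasureTheory.integral_Ioc_eq_integral_Ioo]
    congr 2
    ext x
    simp only [Set.mem_inter_iff, Set.mem_Iio, Set.mem_Ioc, Set.mem_Ioo]
    exact ⟨fun h => ⟨h.2.1, h.1⟩, fun h => ⟨h.2, h.1, h.2.le.trans hτ.2⟩⟩
  have hF_right : ∀ σ, (fun τ => F τ σ) = (Set.Ioi σ).indicator
      (fun τ => (t - τ) ^ (-α) * (τ - σ) ^ (α - 1) * w σ) := by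
    intro σ
    ext τ
    simp only [hF, Set.indicator_apply, Set.mem_Ioi]
  have hset : ∀ σ ∈ Set.Ioo a t, Set.Ioi σ ∩ Set.Ioc a t = Set.Ioc σ t := by
    intro σ hσ
    ext x
    simp only [Set.mem_inter_iff, Set.mem_Ioi, Set.mem_Ioc]
    exact ⟨fun h => ⟨h.1, h.2.2⟩, fun h => ⟨h.1, hσ.1.trans h.1, h.2⟩⟩
  have hker : ∀ σ ∈ Set.Ioo a t, Integrable (fun τ => F τ σ) μ := by
    intro σ hσ
    rw [hF_right, integrable_indicator_iff measurableSet_Ioi, hμ, IntegrableOn,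
      Measure.restrict_restrict measurableSet_Ioi, hset σ hσ, ← IntegrableOn,
      ← intervalIntegrable_iff_integrableOn_Ioc_of_le hσ.2.le]
    exact (intervalIntegrable_sub_rpow_mul_sub_rpow (by linarith) (by linarith) hσ.2).mul_const _
  have hint : ∀ σ ∈ Set.Ioo a t, ∫ τ, F τ σ ∂μ = C * w σ := by
    intro σ hσ
    rw [hF_right, MeasureTheory.integral_indicator measurableSet_Ioi, hμ,
      Measure.restrict_restrict measurableSet_Ioi, hset σ hσ,
      ← intervalIntegral.integral_of_le hσ.2.le, intervalIntegral.integral_mul_const,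
      integral_sub_rpow_mul_sub_rpow α hσ.2]
  have hint_norm : ∀ σ ∈ Set.Ioo a t, ∫ τ, ‖F τ σ‖ ∂μ = C * ‖w σ‖ := by
    intro σ hσ
    have e : (fun τ => ‖F τ σ‖) = (Set.Ioi σ).indicator
        (fun τ => ‖(t - τ) ^ (-α) * (τ - σ) ^ (α - 1) * w σ‖) := by
      ext τ
      rw [congrFun (hF_right σ) τ, norm_indicator_eq_indicator_norm]
    rw [e, MeasureTheory.integral_indicator measurableSet_Ioi, hμ,
      Measure.restrict_restrict measurableSet_Ioi, hset σ hσ,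
      hC, ← integral_sub_rpow_mul_sub_rpow α hσ.2, ← intervalIntegral.integral_mul_const,
      intervalIntegral.integral_of_le hσ.2.le]
    refine setIntegral_congr_fun measurableSet_Ioc fun τ hτ => ?_
    simp only [norm_mul]
    rw [Real.norm_of_nonneg (Real.rpow_nonneg (by linarith [hτ.2]) _),
      Real.norm_of_nonneg (Real.rpow_nonneg (by linarith [hτ.1]) _)]
  have hae : ∀ᵐ σ ∂μ, σ ∈ Set.Ioo a t := by
    rw [hμ, ← restrict_Ioo_eq_restrict_Ioc]
    exact ae_restrict_mem measurableSet_Ioo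
  have hFint : Integrable (Function.uncurry F) (μ.prod μ) := by
    rw [integrable_prod_iff' hmeas.aestronglyMeasurable]
    refine ⟨hae.mono hker, ?_⟩
    have hw' : Integrable (fun σ => C * ‖w σ‖) μ :=
      (intervalIntegrable_iff_integrableOn_Ioc_of_le hat).1
        ((hw.norm.const_mul C).intervalIntegrable a t)
    exact hw'.congr (hae.mono fun σ hσ => (hint_norm σ hσ).symm)
  have hae' : ∀ᵐ τ ∂μ, ∫ σ, F τ σ ∂μ =
      (t - τ) ^ (-α) * ∫ σ in a..τ, (τ - σ) ^ (α - 1) * w σ :=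
    (ae_restrict_mem measurableSet_Ioc).mono hF_left
  refine ⟨?_, ?_⟩
  · rw [intervalIntegrable_iff_integrableOn_Ioc_of_le hat]
    exact hFint.integral_prod_left.congr hae'
  · rw [intervalIntegral.integral_of_le hat, ← MeasureTheory.integral_congr_ae hae',
      integral_integral_swap hFint, MeasureTheory.integral_congr_ae (hae.mono hint),
      MeasureTheory.integral_const_mul, intervalIntegral.integral_of_le hat]

/-- A fractional integral of a nonnegative function vanishing at `b` cannot grow at a positive
linear rate up to `b`. -/
theorem not_linear_growth {α : ℝ} (hα : α ∈ Set.Ioo (0 : ℝ) 1) {w : ℝ → ℝ} (hw : Continuous w)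
    (hw0 : ∀ τ, 0 ≤ w τ) {a b c : ℝ} (hab : a < b) (hwb : w b = 0) (hc : 0 < c)
    (hG : ∀ t ∈ Set.Icc a b, c * (b - t) ≤
      (∫ τ in a..b, (b - τ) ^ (α - 1) * w τ) - ∫ τ in a..t, (t - τ) ^ (α - 1) * w τ) :
    False := by
  have hα' := hα
  obtain ⟨hα0, hα1⟩ := hα'
  set G : ℝ → ℝ := fun t => ∫ τ in a..t, (t - τ) ^ (α - 1) * w τ with hGdef
  replace hG : ∀ t ∈ Set.Icc a b, c * (b - t) ≤ G b - G t := hG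
  set C := ∫ x in (0 : ℝ)..1, (1 - x) ^ (-α) * x ^ (α - 1) with hC
  have habel : ∀ t, a ≤ t → IntervalIntegrable (fun τ => (t - τ) ^ (-α) * G τ) volume a t ∧
      ∫ τ in a..t, (t - τ) ^ (-α) * G τ = C * ∫ σ in a..t, w σ :=
    fun t ht => abel_integral hα hw ht
  set ρ := ((b - a) / 2) ^ (1 - α) / (1 - α) with hρ
  have hρ0 : 0 < ρ := div_pos (Real.rpow_pos_of_pos (by linarith) _) (by linarith)
  obtain ⟨ε, hε0, hε⟩ : ∃ ε > 0, ε * (1 / α + |C|) < c * ρ := by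
    have hK : 0 < 1 / α + |C| := by positivity
    refine ⟨c * ρ / (2 * (1 / α + |C|)), by positivity, ?_⟩
    have : c * ρ / (2 * (1 / α + |C|)) * (1 / α + |C|) = c * ρ / 2 := by field_simp
    rw [this]
    linarith [mul_pos hc hρ0]
  obtain ⟨η, hη0, hη⟩ : ∃ η > 0, ∀ τ, b - η ≤ τ → τ ≤ b → w τ ≤ ε := by
    obtain ⟨η, hη0, hη⟩ := Metric.continuousAt_iff.1 (hw.continuousAt (x := b)) ε hε0
    refine ⟨η / 2, by linarith, fun τ h₁ h₂ => ?_⟩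
    have := @hη τ (by rw [Real.dist_eq, abs_lt]; constructor <;> linarith)
    rw [Real.dist_eq, hwb, sub_zero] at this
    exact (le_abs_self _).trans this.le
  obtain ⟨s, has, hsb, hsη⟩ : ∃ s, (a + b) / 2 ≤ s ∧ s < b ∧ b - η ≤ s :=
    ⟨max ((a + b) / 2) (b - η), le_max_left _ _, max_lt (by linarith) (by linarith),
      le_max_right _ _⟩
  have has' : a ≤ s := by linarith
  set ℓ : ℝ → ℝ := fun τ => G b - c * (b - τ) with hℓ
  have hℓc : Continuous ℓ := by fun_prop
  have hℓ0 : ∀ τ, a ≤ τ → 0 ≤ ℓ τ := by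
    intro τ hτ
    have h₁ := hG a ⟨le_rfl, hab.le⟩
    have h₂ : G a = 0 := by simp [hGdef]
    have h₃ : c * (b - τ) ≤ c * (b - a) := mul_le_mul_of_nonneg_left (by linarith) hc.le
    simp only [hℓ]
    linarith
  set N : ℝ → ℝ := fun τ => ℓ τ - G τ with hN
  have hN0 : ∀ τ ∈ Set.Icc a b, 0 ≤ N τ := by
    intro τ hτ
    have := hG τ hτ
    simp only [hN, hℓ]
    linarith
  have hα1' : -1 < α - 1 := by linarith
  have hα2 : -1 < -α := by linarith
  have hN_le : ∀ τ ∈ Set.Ioo s b, N τ ≤ ε / α * (b - τ) ^ α := by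
    intro τ hτ
    have hker := fun t x y => intervalIntegrable_sub_rpow_mul hα1' hw x y t
    have h₁ : G b = (∫ σ in a..τ, (b - σ) ^ (α - 1) * w σ) +
        ∫ σ in τ..b, (b - σ) ^ (α - 1) * w σ :=
      (intervalIntegral.integral_add_adjacent_intervals (hker _ _ _) (hker _ _ _)).symm
    have h₂ : ∫ σ in a..τ, (b - σ) ^ (α - 1) * w σ ≤ G τ :=
      integral_sub_rpow_mul_antitone (by linarith) (by linarith [hτ.1]) le_rfl hτ.2.le
        (fun σ _ => hw0 σ) (hker _ _ _) (hker _ _ _)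
    have h₃ : ∫ σ in τ..b, (b - σ) ^ (α - 1) * w σ ≤ ∫ σ in τ..b, (b - σ) ^ (α - 1) * ε := by
      refine intervalIntegral.integral_mono_on_of_le_Ioo hτ.2.le (hker _ _ _)
        (intervalIntegrable_sub_rpow_mul hα1' continuous_const _ _ _) fun σ hσ => ?_
      exact mul_le_mul_of_nonneg_left (hη σ (by linarith [hτ.1, hσ.1]) hσ.2.le)
        (Real.rpow_nonneg (by linarith [hσ.2]) _)
    rw [intervalIntegral.integral_mul_const, integral_sub_rpow hα1', sub_add_cancel] at h₃
    have h₄ : 0 ≤ c * (b - τ) := mul_nonneg hc.le (by linarith [hτ.2])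
    have h₅ : (b - τ) ^ α / α * ε = ε / α * (b - τ) ^ α := by ring
    simp only [hN, hℓ]
    linarith
  have hNint : ∀ t, a ≤ t → IntervalIntegrable (fun τ => (t - τ) ^ (-α) * N τ) volume a t := by
    intro t ht
    have := (intervalIntegrable_sub_rpow_mul hα2 hℓc a t t).sub (habel t ht).1
    refine this.congr fun τ _ => ?_
    simp only [hN]
    ring
  have hsplit : ∀ t, a ≤ t → ∫ τ in a..t, (t - τ) ^ (-α) * ℓ τ =
      (∫ τ in a..t, (t - τ) ^ (-α) * N τ) + C * ∫ σ in a..t, w σ := by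
    intro t ht
    rw [← (habel t ht).2, ← intervalIntegral.integral_add (hNint t ht) (habel t ht).1]
    refine intervalIntegral.integral_congr fun τ _ => ?_
    simp only [hN]
    ring
  have hNb := hNint b hab.le
  have hNas : IntervalIntegrable (fun τ => (b - τ) ^ (-α) * N τ) volume a s :=
    hNb.mono_set (by
      rw [Set.uIcc_of_le has', Set.uIcc_of_le hab.le]; exact Set.Icc_subset_Icc_right hsb.le)
  have hNsb : IntervalIntegrable (fun τ => (b - τ) ^ (-α) * N τ) volume s b :=
    hNb.mono_set (by
      rw [Set.uIcc_of_le hsb.le, Set.uIcc_of_le hab.le]; exact Set.Icc_subset_Icc_left has')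
  have hQ : (∫ τ in a..b, (b - τ) ^ (-α) * N τ) - ∫ τ in a..s, (s - τ) ^ (-α) * N τ ≤
      (b - s) * (ε / α) := by
    have h₁ := intervalIntegral.integral_add_adjacent_intervals hNas hNsb
    have h₂ := integral_sub_rpow_mul_antitone (p := -α) (by linarith) has' le_rfl hsb.le
      (fun τ hτ => hN0 τ ⟨hτ.1.le, by linarith [hτ.2]⟩) hNas (hNint s has')
    have h₃ : ∫ τ in s..b, (b - τ) ^ (-α) * N τ ≤ ∫ _ in s..b, ε / α := by
      refine intervalIntegral.integral_mono_on_of_le_Ioo hsb.le hNsb (by simp) fun τ hτ => ?_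
      have hpos : 0 < b - τ := by linarith [hτ.2]
      calc (b - τ) ^ (-α) * N τ ≤ (b - τ) ^ (-α) * (ε / α * (b - τ) ^ α) :=
            mul_le_mul_of_nonneg_left (hN_le τ hτ) (Real.rpow_nonneg hpos.le _)
        _ = ε / α * ((b - τ) ^ (-α) * (b - τ) ^ α) := by ring
        _ = ε / α := by rw [← Real.rpow_add hpos]; simp
    rw [intervalIntegral.integral_const, smul_eq_mul] at h₃
    linarith
  have hK : C * (∫ σ in a..b, w σ) - C * (∫ σ in a..s, w σ) ≤ |C| * (ε * (b - s)) := by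
    rw [← mul_sub, intervalIntegral.integral_interval_sub_left (hw.intervalIntegrable _ _)
      (hw.intervalIntegrable _ _)]
    have h₀ : 0 ≤ ∫ σ in s..b, w σ := intervalIntegral.integral_nonneg hsb.le fun σ _ => hw0 σ
    have h₁ : ∫ σ in s..b, w σ ≤ ∫ _ in s..b, ε :=
      intervalIntegral.integral_mono_on_of_le_Ioo hsb.le (hw.intervalIntegrable _ _) (by simp)
        fun σ hσ => hη σ (by linarith [hσ.1]) hσ.2.le
    rw [intervalIntegral.integral_const, smul_eq_mul, mul_comm] at h₁
    exact mul_le_mul (le_abs_self C) h₁ h₀ (abs_nonneg C)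
  have hP : c * (b - s) * ρ ≤
      (∫ τ in a..b, (b - τ) ^ (-α) * ℓ τ) - ∫ τ in a..s, (s - τ) ^ (-α) * ℓ τ := by
    have hsub : ∀ t, ∫ τ in a..t, (t - τ) ^ (-α) * ℓ τ =
        ∫ x in (0 : ℝ)..(t - a), x ^ (-α) * ℓ (t - x) := by
      intro t
      have := intervalIntegral.integral_comp_sub_left (a := a) (b := t)
        (fun x => x ^ (-α) * ℓ (t - x)) t
      simpa only [sub_sub_cancel, sub_self] using this
    have hi : ∀ t x y, IntervalIntegrable (fun x => x ^ (-α) * ℓ (t - x)) volume x y :=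
      fun t x y => (intervalIntegrable_rpow' hα2).mul_continuousOn
        (hℓc.comp (continuous_const.sub continuous_id)).continuousOn
    rw [hsub, hsub, ← intervalIntegral.integral_add_adjacent_intervals (hi b 0 (s - a))
      (hi b (s - a) (b - a)), add_sub_right_comm,
      ← intervalIntegral.integral_sub (hi _ _ _) (hi _ _ _)]
    have h₁ : 0 ≤ ∫ x in (s - a)..(b - a), x ^ (-α) * ℓ (b - x) := by
      refine intervalIntegral.integral_nonneg (by linarith) fun x hx => ?_
      exact mul_nonneg (Real.rpow_nonneg (by linarith [hx.1]) _) (hℓ0 _ (by linarith [hx.2]))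
    have h₂ : ∫ x in (0 : ℝ)..(s - a), (x ^ (-α) * ℓ (b - x) - x ^ (-α) * ℓ (s - x)) =
        (s - a) ^ (1 - α) / (1 - α) * (c * (b - s)) := by
      have e : ∀ x : ℝ, x ^ (-α) * ℓ (b - x) - x ^ (-α) * ℓ (s - x) =
          x ^ (-α) * (c * (b - s)) := fun x => by simp only [hℓ]; ring
      simp only [e]
      rw [intervalIntegral.integral_mul_const, integral_rpow (Or.inl hα2),
        show -α + 1 = 1 - α by ring, Real.zero_rpow (by linarith), sub_zero]
    have h₃ : ρ ≤ (s - a) ^ (1 - α) / (1 - α) :=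
      div_le_div_of_nonneg_right
        (Real.rpow_le_rpow (by linarith) (by linarith) (by linarith)) (by linarith)
    have h₄ := mul_le_mul_of_nonneg_right h₃ (mul_nonneg hc.le (sub_nonneg.2 hsb.le))
    linarith
  rw [hsplit b hab.le, hsplit s has'] at hP
  have hfin := mul_lt_mul_of_pos_right hε (sub_pos.2 hsb)
  have e : ε * (1 / α + |C|) * (b - s) = (b - s) * (ε / α) + |C| * (ε * (b - s)) := by ring
  linarith

/-- Riemann–Liouville extremum principle (Al-Refai–Luchko type). -/
theorem rl_extremum_principle
    (α T : ℝ) (hα : α ∈ Set.Ioo (0:ℝ) 1) (hT : 0 < T)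
    (z : ℝ → ℝ) (hz : ContinuousOn z (Set.Icc 0 T)) (hz0 : z 0 = 0)
    (t₁ : ℝ) (ht₁ : t₁ ∈ Set.Ioc 0 T)
    (hpos : 0 < z t₁) (hmax : ∀ t, t ∈ Set.Icc 0 T → z t ≤ z t₁)
    (D : ℝ) (hD : HasDerivAt (rlIntegral α z) D t₁) :
    t₁ ^ (α - 1) / Real.Gamma α * z t₁ ≤ D ∧ 0 < t₁ ^ (α - 1) / Real.Gamma α * z t₁ := by
  have hα' := hα
  obtain ⟨hα0, hα1⟩ := hα'
  obtain ⟨ht0, htT⟩ := ht₁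
  have hΓ : 0 < Real.Gamma α := Real.Gamma_pos_of_pos hα0
  refine ⟨?_, mul_pos (div_pos (Real.rpow_pos_of_pos ht0 _) hΓ) hpos⟩
  by_contra! hlt
  have hα1' : -1 < α - 1 := by linarith
  set y : ℝ → ℝ := Set.IccExtend hT.le ((Set.Icc 0 T).domRestrict z) with hy
  have hyc : Continuous y := (continuousOn_iff_continuous_domRestrict.1 hz).Icc_extend'
  have hyz : ∀ t ∈ Set.Icc 0 T, y t = z t := fun t ht => by
    rw [hy, Set.IccExtend_of_mem _ _ ht, Set.domRestrict_apply]
  set w : ℝ → ℝ := fun t => z t₁ - y t with hw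
  have hwc : Continuous w := continuous_const.sub hyc
  have hw0 : ∀ t, 0 ≤ w t := fun t => sub_nonneg.2 (hmax _ (Set.projIcc 0 T hT.le t).2)
  have hwt : w t₁ = 0 := by simp only [hw, hyz t₁ ⟨ht0.le, htT⟩, sub_self]
  have hker := fun t x y => intervalIntegrable_sub_rpow_mul hα1' hwc x y t
  set F : ℝ → ℝ := fun t => ∫ τ in (0:ℝ)..t, (t - τ) ^ (α - 1) * w τ with hF
  have hFrl : ∀ t ∈ Set.Ioc 0 t₁, F t = z t₁ * (t ^ α / α) - Real.Gamma α * rlIntegral α z t := by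
    intro t ht
    have e₁ : ∫ τ in (0:ℝ)..t, (t - τ) ^ (α - 1) * z τ =
        ∫ τ in (0:ℝ)..t, (t - τ) ^ (α - 1) * y τ := by
      refine intervalIntegral.integral_congr fun τ hτ => ?_
      rw [Set.uIcc_of_le ht.1.le] at hτ
      simp only [hyz τ ⟨hτ.1, hτ.2.trans (ht.2.trans htT)⟩]
    have e₂ : F t = (∫ τ in (0:ℝ)..t, (t - τ) ^ (α - 1) * z t₁) -
        ∫ τ in (0:ℝ)..t, (t - τ) ^ (α - 1) * y τ := by
      rw [← intervalIntegral.integral_sub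
        (intervalIntegrable_sub_rpow_mul hα1' continuous_const _ _ _)
        (intervalIntegrable_sub_rpow_mul hα1' hyc _ _ _)]
      simp only [hF, hw, mul_sub]
    rw [e₂, rlIntegral, e₁, intervalIntegral.integral_mul_const, integral_sub_rpow hα1',
      sub_add_cancel, sub_zero]
    field_simp
  have hFd : HasDerivWithinAt F (z t₁ * t₁ ^ (α - 1) - Real.Gamma α * D) (Set.Iio t₁) t₁ := by
    have h₁ := (((Real.hasDerivAt_rpow_const (p := α) (Or.inl ht0.ne')).div_const α).const_mul
      (z t₁)).sub (hD.const_mul (Real.Gamma α))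
    rw [mul_div_cancel_left₀ _ hα0.ne'] at h₁
    refine h₁.hasDerivWithinAt.congr_of_eventuallyEq ?_ (hFrl t₁ ⟨ht0, le_rfl⟩)
    filter_upwards [Ioo_mem_nhdsLT ht0] with t ht using hFrl t ⟨ht.1, ht.2.le⟩
  set d := z t₁ * t₁ ^ (α - 1) - Real.Gamma α * D with hd
  have hd0 : 0 < d := by
    have := mul_lt_mul_of_pos_left hlt hΓ
    have e : Real.Gamma α * (t₁ ^ (α - 1) / Real.Gamma α * z t₁) = z t₁ * t₁ ^ (α - 1) := by
      field_simp
    linarith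
  rw [hasDerivWithinAt_iff_tendsto_slope' (by simp)] at hFd
  obtain ⟨l, hl, hslope⟩ := (mem_nhdsLT_iff_exists_Ioo_subset' ht0).1
    (hFd.eventually (lt_mem_nhds (half_lt_self hd0)))
  obtain ⟨a, hla, h0a, hat⟩ : ∃ a, l < a ∧ 0 < a ∧ a < t₁ := by
    obtain ⟨a, ha, hat⟩ := exists_between (max_lt hl ht0)
    exact ⟨a, (le_max_left _ _).trans_lt ha, (le_max_right _ _).trans_lt ha, hat⟩
  refine not_linear_growth hα hwc hw0 hat hwt (half_pos hd0) fun t ht => ?_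
  rcases ht.2.eq_or_lt with rfl | htlt
  · simp
  have h₁ : d / 2 < slope F t₁ t := hslope ⟨hla.trans_le ht.1, htlt⟩
  rw [slope_comm, slope_def_field, lt_div_iff₀ (sub_pos.2 htlt)] at h₁
  have h₂ := integral_sub_rpow_mul_antitone (p := α - 1) (by linarith) h0a.le ht.1 ht.2
    (fun τ _ => hw0 τ) (hker t₁ 0 a) (hker t 0 a)
  have h₃ : F t₁ = _ :=
    (intervalIntegral.integral_add_adjacent_intervals (hker t₁ 0 a) (hker t₁ a t₁)).symm
  have h₄ : F t = _ :=
    (intervalIntegral.integral_add_adjacent_intervals (hker t 0 a) (hker t a t)).symm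
  linarith
end

section
/- Let $\alpha\in(0,1)$, $\lambda>0$, $T>0$, and let $p:[0,T]\to\mathbb{R}$ be continuous with $0<p_0\le p(t)\le p_1$. Suppose $z\in C^2([0,T])$ satisfies $z(t)\ge 0$ and $z'(t)+p(t)\,\partial_t^\alpha z(t)+\lambda z(t)\le 0$ for all $t\in(0,T)$. Then $\partial_t^\alpha z(t)\le 0$ for all $t\in(0,T)$. -/
open Real MeasureTheory intervalIntegral

/-- Caputo fractional derivative of order `α` of `z` at `t`. -/
noncomputable def caputoDeriv (α : ℝ) (z : ℝ → ℝ) (t : ℝ) : ℝ :=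
  (1 / Real.Gamma (1 - α)) * ∫ τ in (0:ℝ)..t, (t - τ) ^ (-α) * deriv z τ

/-- The truncated Abel integral of `v` with upper limit `x` and kernel pole at `a`. -/
noncomputable def truncAbel (α : ℝ) (v : ℝ → ℝ) (x a : ℝ) : ℝ :=
  ∫ s in (0:ℝ)..x, (a - s) ^ (-α) * v s

theorem intervalIntegrable_abel {α : ℝ} (hα : α < 1) {v : ℝ → ℝ} (hv : Continuous v)
    (a x y : ℝ) : IntervalIntegrable (fun s => (a - s) ^ (-α) * v s) volume x y := by
  have h : IntervalIntegrable (fun s : ℝ => s ^ (-α)) volume (a - x) (a - y) :=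
    intervalIntegrable_rpow' (by linarith)
  have h' := h.comp_sub_left a
  simp only [sub_sub_cancel] at h'
  exact h'.mul_continuousOn hv.continuousOn

theorem continuous_abel_primitive {α : ℝ} (hα : α < 1) {v : ℝ → ℝ} (hv : Continuous v) :
    Continuous fun q : ℝ × ℝ => ∫ s in (0:ℝ)..q.2, s ^ (-α) * v (q.1 - s) := by
  rw [continuous_iff_continuousAt]
  rintro ⟨a, y⟩
  set K : ℝ := |y| + 1 with hK
  have hy := neg_abs_le y
  have hy' := le_abs_self y
  obtain ⟨C, hC⟩ := (isCompact_Icc (a := a - 1 - K) (b := a + 1 + K)).exists_bound_of_continuousOn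
    hv.continuousOn
  refine continuousAt_parametric_primitive_of_dominated
    (F := fun a s => s ^ (-α) * v (a - s)) (fun s => ‖s ^ (-α)‖ * C) (-K) K
    (a₀ := 0) (b₀ := y) (x₀ := a) ?_ ?_ ?_ ?_ ?_ ?_ ?_
  · intro b
    have : Measurable fun s : ℝ => s ^ (-α) * v (b - s) := by
      have := hv.measurable
      fun_prop
    exact this.aestronglyMeasurable
  · filter_upwards [Metric.ball_mem_nhds a one_pos] with b hb
    filter_upwards [ae_restrict_mem measurableSet_uIoc] with s hs
    rw [Set.uIoc_of_le (by linarith [abs_nonneg y])] at hs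
    rw [Real.ball_eq_Ioo] at hb
    rw [norm_mul]
    gcongr
    exact hC _ ⟨by linarith [hb.1, hs.2], by linarith [hb.2, hs.1]⟩
  · exact (intervalIntegrable_rpow' (by linarith)).norm.mul_const C
  · exact Filter.Eventually.of_forall fun s => by fun_prop
  · constructor <;> linarith [abs_nonneg y]
  · constructor <;> linarith
  · simp

theorem truncAbel_eq_sub {α : ℝ} (hα : α < 1) {v : ℝ → ℝ} (hv : Continuous v) (x a : ℝ) :
    truncAbel α v x a = (∫ s in (0:ℝ)..a, s ^ (-α) * v (a - s))
      - ∫ s in (0:ℝ)..(a - x), s ^ (-α) * v (a - s) := by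
  have h : ∀ y, IntervalIntegrable (fun s => s ^ (-α) * v (a - s)) volume 0 y := fun y =>
    (intervalIntegrable_rpow' (by linarith)).mul_continuousOn (by fun_prop)
  rw [integral_interval_sub_left (h _) (h _)]
  have := integral_comp_sub_left (a := 0) (b := x) (fun s => s ^ (-α) * v (a - s)) a
  simp only [sub_sub_cancel, sub_zero] at this
  exact this

theorem continuous_truncAbel {α : ℝ} (hα : α < 1) {v : ℝ → ℝ} (hv : Continuous v) :
    Continuous fun q : ℝ × ℝ => truncAbel α v q.1 q.2 := by
  simp only [truncAbel_eq_sub hα hv]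
  have h := continuous_abel_primitive hα hv
  exact (h.comp (f := fun q : ℝ × ℝ => (q.2, q.2)) (by fun_prop)).sub
    (h.comp (f := fun q : ℝ × ℝ => (q.2, q.2 - q.1)) (by fun_prop))

theorem hasDerivAt_truncAbel {α : ℝ} (hα : α < 1) {v : ℝ → ℝ} (hv : Continuous v)
    {x a : ℝ} (hxa : x < a) :
    HasDerivAt (fun y => truncAbel α v y a) ((a - x) ^ (-α) * v x) x := by
  refine integral_hasDerivAt_right (intervalIntegrable_abel hα hv a 0 x) ?_ ?_
  · have : Measurable fun s : ℝ => (a - s) ^ (-α) * v s := by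
      have := hv.measurable
      fun_prop
    exact this.stronglyMeasurable.stronglyMeasurableAtFilter
  · have h : ContinuousAt (fun s : ℝ => (a - s) ^ (-α)) x :=
      (continuousAt_const.sub continuousAt_id).rpow_const (Or.inl (by simp; linarith))
    exact h.mul hv.continuousAt

/-- Moving the pole of the kernel from `x` to `a > x` contracts upper bounds. -/
theorem truncAbel_le_of_forall_le {α : ℝ} (hα₀ : 0 < α) (hα : α < 1) {v : ℝ → ℝ}
    (hv : Continuous v) {x a M : ℝ} (hx : 0 < x) (hxa : x < a)
    (hM : ∀ y ∈ Set.Icc 0 x, truncAbel α v y x ≤ M) :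
    truncAbel α v x a ≤ x ^ α * a ^ (-α) * M := by
  have hcont : ∀ b, Continuous fun y => truncAbel α v y b := fun b =>
    (continuous_truncAbel hα hv).comp (f := fun y => (y, b)) (by fun_prop)
  let φ : ℝ → ℝ := fun y =>
    truncAbel α v y a + (x - y) ^ α * (a - y) ^ (-α) * (M - truncAbel α v y x)
  have hanti : AntitoneOn φ (Set.Icc 0 x) := by
    have hder : ∀ y ∈ interior (Set.Icc 0 x), HasDerivAt φ
        (α * (x - y) ^ (α - 1) * (a - y) ^ (-α - 1) * (x - a) * (M - truncAbel α v y x)) y := by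
      intro y hy
      rw [interior_Icc] at hy
      have hxy : 0 < x - y := sub_pos.2 hy.2
      have hay : 0 < a - y := by linarith
      have h₁ := ((hasDerivAt_id y).const_sub x).rpow_const (p := α) (Or.inl hxy.ne')
      have h₂ := ((hasDerivAt_id y).const_sub a).rpow_const (p := -α) (Or.inl hay.ne')
      have h := (hasDerivAt_truncAbel hα hv (hy.2.trans hxa)).add
        ((h₁.mul h₂).mul ((hasDerivAt_truncAbel hα hv hy.2).const_sub M))
      refine h.congr_deriv ?_
      have e₁ : (x - y) ^ α = (x - y) ^ (α - 1) * (x - y) := by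
        rw [← rpow_add_one hxy.ne', sub_add_cancel]
      have e₂ : (a - y) ^ (-α) = (a - y) ^ (-α - 1) * (a - y) := by
        rw [← rpow_add_one hay.ne', sub_add_cancel]
      have e₃ : (x - y) ^ α * (x - y) ^ (-α) = 1 := by
        rw [← rpow_add hxy, add_neg_cancel, rpow_zero]
      simp only [id, Pi.mul_apply]
      linear_combination (-(a - y) ^ (-α) * v y) * e₃
        - α * (x - y) ^ (α - 1) * (M - truncAbel α v y x) * e₂
        + α * (a - y) ^ (-α - 1) * (M - truncAbel α v y x) * e₁
    refine antitoneOn_of_deriv_nonpos (convex_Icc 0 x) ?_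
      (fun y hy => (hder y hy).differentiableAt.differentiableWithinAt) ?_
    · refine (hcont a).continuousOn.add (ContinuousOn.mul (ContinuousOn.mul ?_ ?_)
        (continuous_const.sub (hcont x)).continuousOn)
      · exact (continuous_const.sub continuous_id).continuousOn.rpow_const
          fun _ _ => Or.inr hα₀.le
      · exact (continuous_const.sub continuous_id).continuousOn.rpow_const
          fun y hy => Or.inl ((sub_pos.2 (hy.2.trans_lt hxa)).ne')
    · intro y hy
      rw [(hder y hy).deriv]
      rw [interior_Icc] at hy
      have hxy : 0 < x - y := sub_pos.2 hy.2
      have hay : 0 < a - y := by linarith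
      have := hM y ⟨hy.1.le, hy.2.le⟩
      refine mul_nonpos_of_nonpos_of_nonneg (mul_nonpos_of_nonneg_of_nonpos ?_ ?_) ?_
      · positivity
      · linarith
      · linarith
  have h := hanti (Set.left_mem_Icc.2 hx.le) (Set.right_mem_Icc.2 hx.le) hx.le
  have h0 : ∀ b, truncAbel α v 0 b = 0 := fun b => integral_same
  simpa [φ, h0, zero_rpow hα₀.ne'] using h

/-- If `v` is negative wherever its Abel integral is positive, the Abel integral is nowhere
positive. -/
theorem truncAbel_self_nonpos {α : ℝ} (hα₀ : 0 < α) (hα : α < 1) {v : ℝ → ℝ}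
    (hv : Continuous v) {b : ℝ} (hb : 0 ≤ b)
    (hneg : ∀ t ∈ Set.Ioc 0 b, 0 < truncAbel α v t t → v t < 0) :
    truncAbel α v b b ≤ 0 := by
  by_contra! hpos
  have h0 : ∀ a, truncAbel α v 0 a = 0 := fun a => integral_same
  let S : Set (ℝ × ℝ) := (Set.Icc 0 b ×ˢ Set.Icc 0 b) ∩ {q | q.1 ≤ q.2}
  have hS : IsCompact S := (isCompact_Icc.prod isCompact_Icc).inter_right
    (isClosed_le continuous_fst continuous_snd)
  have hbS : (b, b) ∈ S := ⟨⟨⟨hb, le_rfl⟩, ⟨hb, le_rfl⟩⟩, le_refl b⟩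
  obtain ⟨⟨x, a⟩, ⟨⟨⟨hx0, hxb⟩, ha0, hab⟩, hxa⟩, hmax⟩ :=
    hS.exists_isMaxOn ⟨_, hbS⟩ (continuous_truncAbel hα hv).continuousOn
  simp only at hx0 hxb ha0 hab
  replace hxa : x ≤ a := hxa
  have hle : ∀ y c, 0 ≤ y → y ≤ c → c ≤ b → truncAbel α v y c ≤ truncAbel α v x a :=
    fun y c hy hyc hc => hmax (a := (y, c))
      ⟨⟨⟨hy, hyc.trans hc⟩, ⟨hy.trans hyc, hc⟩⟩, hyc⟩
  have hM : 0 < truncAbel α v x a := hpos.trans_le (hle b b hb le_rfl le_rfl)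
  have hx : 0 < x := hx0.lt_of_ne fun h => by rw [← h, h0] at hM; exact hM.false
  rcases hxa.lt_or_eq with hxa | rfl
  · have h := truncAbel_le_of_forall_le hα₀ hα hv hx hxa
      fun y hy => hle y x hy.1 hy.2 hxb
    have hr : x ^ α * a ^ (-α) < 1 := by
      have ha : 0 < a := hx.trans hxa
      rw [rpow_neg ha.le, ← div_eq_mul_inv, div_lt_one (by positivity)]
      exact rpow_lt_rpow hx.le hxa hα₀
    nlinarith
  · have hvx := hneg x ⟨hx, hxb⟩ hM
    obtain ⟨l, hl, hlx⟩ := exists_Ioc_subset_of_mem_nhds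
      (hv.continuousAt.eventually_lt continuousAt_const hvx) ⟨0, hx⟩
    let y := max l 0
    have hyx : y < x := max_lt hl hx
    have hanti : StrictAntiOn (fun s => truncAbel α v s x) (Set.Icc y x) := by
      refine strictAntiOn_of_deriv_neg (convex_Icc y x) ?_ ?_
      · exact ((continuous_truncAbel hα hv).comp (f := fun s => (s, x))
          (by fun_prop)).continuousOn
      · intro s hs
        rw [interior_Icc] at hs
        rw [(hasDerivAt_truncAbel hα hv hs.2).deriv]
        exact mul_neg_of_pos_of_neg (rpow_pos_of_pos (sub_pos.2 hs.2) _)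
          (hlx ⟨(le_max_left l 0).trans_lt hs.1, hs.2.le⟩)
    exact (hle y x (le_max_right l 0) hyx.le hxb).not_gt
      (hanti (Set.left_mem_Icc.2 hyx.le) (Set.right_mem_Icc.2 hyx.le) hyx)

/-- Nonpositivity of the Caputo derivative of a nonnegative decaying solution (Lemma 4.3). -/
theorem caputo_nonpos_of_decaying
    (α lam T p₀ p₁ : ℝ) (hα : α ∈ Set.Ioo (0:ℝ) 1) (hlam : 0 < lam) (hT : 0 < T)
    (p : ℝ → ℝ) (hp_cont : ContinuousOn p (Set.Icc 0 T))
    (hp₀ : 0 < p₀) (hp_bounds : ∀ t, t ∈ Set.Icc 0 T → p₀ ≤ p t ∧ p t ≤ p₁)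
    (z : ℝ → ℝ) (hz : ContDiff ℝ 2 z)
    (hz_nonneg : ∀ t, t ∈ Set.Icc 0 T → 0 ≤ z t)
    (hineq : ∀ t, t ∈ Set.Ioo 0 T →
      deriv z t + p t * caputoDeriv α z t + lam * z t ≤ 0) :
    ∀ t, t ∈ Set.Ioo 0 T → caputoDeriv α z t ≤ 0 := by
  intro t ht
  have hΓ : 0 < 1 / Real.Gamma (1 - α) := one_div_pos.2 (Gamma_pos_of_pos (sub_pos.2 hα.2))
  have hv : Continuous (deriv z) := hz.continuous_deriv (by norm_num)
  refine mul_nonpos_of_nonneg_of_nonpos hΓ.le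
    (truncAbel_self_nonpos hα.1 hα.2 hv ht.1.le fun s hs hpos => ?_)
  have hsT : s < T := hs.2.trans_lt ht.2
  have hs' : s ∈ Set.Icc 0 T := ⟨hs.1.le, hsT.le⟩
  have hD : 0 < caputoDeriv α z s := mul_pos hΓ hpos
  have h₁ := mul_pos (hp₀.trans_le (hp_bounds s hs').1) hD
  have h₂ := mul_nonneg hlam.le (hz_nonneg s hs')
  linarith [hineq s ⟨hs.1, hsT⟩]
end
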